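/- arXiv:1701.08639 — 5 statements merged into one kernel-verified Lean document; each statement's English description precedes it below -/
import Mathlib

section
/- For every β ≥ 0 there exists a constant C = C(β) > 0 such that for all sufficiently large m, max_{0 ≤ k ≤ m} | (1/m)·log g(β,k,m) − F(β,k/m) | ≤ C/m. -/
open Filter MeasureTheory

/-- `f(β,t) = (c(1−2t) + √(1+(c²−1)(1−2t)²))/(2(1−t))` with `c = exp(−2β)`. -/
noncomputable def fIsing (β t : ℝ) : ℝ :=
  (Real.exp (-2*β) * (1 - 2*t) +
    Real.sqrt (1 + (Real.exp (-2*β)^2 - 1) * (1 - 2*t)^2)) / (2*(1-t))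

/-- `F(β,t) = ∫₀^{min(t,1−t)} log f(β,s) ds`. -/
noncomputable def FIsing (β t : ℝ) : ℝ :=
  ∫ s in (0:ℝ)..(min t (1-t)), Real.log (fIsing β s)

/-- Auxiliary recursion for `g(β,·,m)` on `0 ≤ k ≤ ⌊m/2⌋`. -/
noncomputable def gAux (β : ℝ) (m : ℕ) : ℕ → ℝ
  | 0 => 1
  | 1 => Real.exp (-2*β)
  | (k+2) => (((m:ℝ) - 2*((k:ℝ)+2) + 2) * Real.exp (-2*β) / ((m:ℝ) - ((k:ℝ)+2) + 1)) *
        gAux β m (k+1)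
      + (((k:ℝ)+1) / ((m:ℝ) - ((k:ℝ)+2) + 1)) * gAux β m k

/-- `g(β,k,m) = E[exp(−2β X(k,m))]`, given by the recursion together with the
symmetry `g(β,k,m) = g(β,m−k,m)`. -/
noncomputable def gIsing (β : ℝ) (k m : ℕ) : ℝ :=
  if k ≤ m/2 then gAux β m k else gAux β m (m - k)

/-- `I(t) = (t−1)log(1−t) − t log t` (with `I(0)=I(1)=0` via `Real.log 0 = 0`). -/
noncomputable def IIsing (t : ℝ) : ℝ := (t-1) * Real.log (1-t) - t * Real.log t

/-- `H(t) = I(t) + d F(β,t)`. -/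
noncomputable def HIsing (β : ℝ) (d : ℕ) (t : ℝ) : ℝ := IIsing t + d * FIsing β t

/-- `L(t) = H(t) + 2Bt`. -/
noncomputable def LIsing (β B : ℝ) (d : ℕ) (t : ℝ) : ℝ := HIsing β d t + 2*B*t

/-- The annealed pressure `ψ(β,B) = βd/2 − B + max_{0≤t≤1} L(t)`. -/
noncomputable def psiIsing (β B : ℝ) (d : ℕ) : ℝ :=
  β*(d:ℝ)/2 - B + sSup ((LIsing β B d) '' Set.Icc (0:ℝ) 1)

/-- The (unnormalized) annealed weight of having `j` plus spins:
`x_j = C(n,j) e^{2Bj} g(β,dj,dn)`. -/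
noncomputable def xw (β B : ℝ) (d n j : ℕ) : ℝ :=
  (n.choose j : ℝ) * Real.exp (2*B*(j:ℝ)) * gIsing β (d*j) (d*n)

/-- The inverse hyperbolic tangent: `artanh x = (1/2) log((1+x)/(1−x))`. -/
noncomputable def artanh (x : ℝ) : ℝ := (1/2) * Real.log ((1+x)/(1-x))


lemma aux_arg_pos (c t : ℝ) (hc : 0 < c) (hc1 : c ≤ 1) (h0 : 0 ≤ t) (h1 : t ≤ 1/2) :
    0 < 1 + (c^2 - 1) * (1 - 2*t)^2 := by
  have h2 : (1 - 2*t)^2 ≤ 1 := by nlinarith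
  have h3 : 0 < c^2 := by positivity
  nlinarith [sq_nonneg (1 - 2*t), mul_nonneg (sub_nonneg.2 h2) (by nlinarith : 0 ≤ 1 - c^2)]

lemma aux_f_pos (β t : ℝ) (hβ : 0 ≤ β) (h0 : 0 ≤ t) (h1 : t ≤ 1/2) : 0 < fIsing β t := by
  have hc := Real.exp_pos (-2*β)
  have hc1 : Real.exp (-2*β) ≤ 1 := Real.exp_le_one_iff.2 (by linarith)
  have := Real.sqrt_pos.2 (aux_arg_pos _ t hc hc1 h0 h1)
  unfold fIsing
  apply div_pos _ (by linarith)
  have : 0 ≤ Real.exp (-2*β) * (1 - 2*t) := mul_nonneg hc.le (by linarith)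
  linarith

lemma aux_f_quad (β t : ℝ) (hβ : 0 ≤ β) (h0 : 0 ≤ t) (h1 : t ≤ 1/2) :
    fIsing β t ^ 2 = (1 - 2*t) * Real.exp (-2*β) / (1 - t) * fIsing β t + t / (1 - t) := by
  have hc := Real.exp_pos (-2*β)
  have hc1 : Real.exp (-2*β) ≤ 1 := Real.exp_le_one_iff.2 (by linarith)
  have hs := Real.sq_sqrt (aux_arg_pos _ t hc hc1 h0 h1).le
  have ht : (1 - t) ≠ 0 := by linarith
  unfold fIsing
  set S := Real.sqrt (1 + (Real.exp (-2*β)^2 - 1) * (1 - 2*t)^2)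
  set c := Real.exp (-2*β)
  field_simp
  linear_combination hs

lemma aux_lip (β : ℝ) (hβ : 0 ≤ β) : ∃ K : NNReal,
    LipschitzOnWith K (fun t => Real.log (fIsing β t)) (Set.Icc 0 (1/2)) := by
  have hc := Real.exp_pos (-2*β)
  have hc1 : Real.exp (-2*β) ≤ 1 := Real.exp_le_one_iff.2 (by linarith)
  have h : ContDiffOn ℝ 1 (fun t => Real.log (fIsing β t)) (Set.Icc 0 (1/2)) := by
    intro t ht
    apply ContDiffAt.contDiffWithinAt
    apply ContDiffAt.log
    · unfold fIsing
      apply ContDiffAt.div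
      · apply ContDiffAt.add (by fun_prop)
        apply ContDiffAt.sqrt (by fun_prop)
        exact (aux_arg_pos _ t hc hc1 ht.1 ht.2).ne'
      · fun_prop
      · have := ht.2
        intro h; linarith
    · exact (aux_f_pos β t hβ ht.1 ht.2).ne'
  exact h.exists_lipschitzOnWith one_ne_zero (convex_Icc _ _) isCompact_Icc

lemma aux_int (L : ℝ → ℝ) (K : NNReal) (hL : LipschitzOnWith K L (Set.Icc 0 (1/2)))
    (x y s : ℝ) (hx : 0 ≤ x) (hxy : x ≤ y) (hy : y ≤ 1/2) (hs : s ∈ Set.Icc x y) :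
    |(∫ u in x..y, L u) - (y - x) * L s| ≤ K * (y - x) * (y - x) := by
  have hi : IntervalIntegrable L volume x y := by
    apply ContinuousOn.intervalIntegrable
    rw [Set.uIcc_of_le hxy]
    exact hL.continuousOn.mono (Set.Icc_subset_Icc hx hy)
  have h1 : (∫ u in x..y, L u) - (y - x) * L s = ∫ u in x..y, (L u - L s) := by
    rw [intervalIntegral.integral_sub hi (by simp)]
    simp
  rw [h1, ← Real.norm_eq_abs]
  refine (intervalIntegral.norm_integral_le_of_norm_le_const (C := K * (y-x)) ?_).trans ?_
  · intro u hu
    rw [Set.uIoc_of_le hxy] at hu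
    have h2 := hL.dist_le_mul u ⟨by linarith [hu.1], by linarith [hu.2]⟩ s
      ⟨by linarith [hs.1], by linarith [hs.2]⟩
    rw [Real.dist_eq, Real.dist_eq] at h2
    rw [Real.norm_eq_abs]
    refine h2.trans (mul_le_mul_of_nonneg_left ?_ K.2)
    rw [abs_le]
    constructor <;> linarith [hs.1, hs.2, hu.1, hu.2]
  · rw [abs_of_nonneg (by linarith)]

/-- Increment bounds: `E` is `m * ∫_0^{k/m} log f`. -/
lemma aux_step (β : ℝ) (hβ : 0 ≤ β) (K : NNReal)
    (hK : LipschitzOnWith K (fun t => Real.log (fIsing β t)) (Set.Icc 0 (1/2)))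
    (m k : ℕ) (hm : 0 < m) (hk : 2 * (k + 1) ≤ m) (s : ℝ)
    (hs : s ∈ Set.Icc ((k:ℝ)/m) (((k+1:ℕ):ℝ)/m)) :
    |(m * ∫ u in (0:ℝ)..(((k+1:ℕ):ℝ)/m), Real.log (fIsing β u))
      - (m * ∫ u in (0:ℝ)..((k:ℝ)/m), Real.log (fIsing β u)) - Real.log (fIsing β s)| ≤ K / m := by
  have hm' : (0:ℝ) < m := by exact_mod_cast hm
  have hk' : 2 * ((k:ℝ) + 1) ≤ m := by exact_mod_cast hk
  have hx : (0:ℝ) ≤ (k:ℝ)/m := by positivity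
  have hxy : (k:ℝ)/m ≤ ((k+1:ℕ):ℝ)/m := by
    gcongr; simp
  have hy : ((k+1:ℕ):ℝ)/m ≤ 1/2 := by
    rw [div_le_div_iff₀ hm' (by norm_num)]; push_cast; linarith
  have hd : ((k+1:ℕ):ℝ)/m - (k:ℝ)/m = 1/m := by push_cast; ring
  have h := aux_int _ K hK _ _ s hx hxy hy hs
  have hii : ∀ a b : ℝ, 0 ≤ a → a ≤ b → b ≤ 1/2 →
      IntervalIntegrable (fun t => Real.log (fIsing β t)) volume a b := by
    intro a b ha hab hb
    apply ContinuousOn.intervalIntegrable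
    rw [Set.uIcc_of_le hab]
    exact hK.continuousOn.mono (Set.Icc_subset_Icc ha hb)
  rw [← intervalIntegral.integral_interval_sub_left (hii 0 _ le_rfl (hx.trans hxy) hy)
    (hii 0 _ le_rfl hx (hxy.trans hy)), hd] at h
  have h3 := mul_le_mul_of_nonneg_left h hm'.le
  rw [← abs_of_pos hm', ← abs_mul, abs_of_pos hm'] at h3
  have e3 : (m:ℝ) * (K * (1 / m) * (1 / m)) = K / m := by field_simp
  have e4 : ∀ a b l : ℝ, (m:ℝ) * (a - b - 1 / m * l) = m * a - m * b - l := by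
    intro a b l; field_simp
  rw [e3, e4] at h3
  exact h3

lemma aux_main (β : ℝ) (hβ : 0 ≤ β) (K : NNReal)
    (hK : LipschitzOnWith K (fun t => Real.log (fIsing β t)) (Set.Icc 0 (1/2)))
    (m : ℕ) (hm : 0 < m) (E : ℕ → ℝ)
    (hE : ∀ k, E k = m * ∫ u in (0:ℝ)..((k:ℝ)/m), Real.log (fIsing β u)) (k : ℕ) :
    (2 * k ≤ m → Real.exp (E k - K * k / m) ≤ gAux β m k ∧
      gAux β m k ≤ Real.exp (E k + K * k / m)) := by
  have hm' : (0:ℝ) < m := by exact_mod_cast hm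
  have key : ∀ k, 2 * (k+1) ≤ m → ∀ s ∈ Set.Icc ((k:ℝ)/m) (((k+1:ℕ):ℝ)/m),
      fIsing β s * Real.exp (E k + K * k / m) ≤ Real.exp (E (k+1) + K * (k+1:ℕ) / m) ∧
      Real.exp (E (k+1) - K * (k+1:ℕ) / m) ≤ fIsing β s * Real.exp (E k - K * k / m) := by
    intro k hk s hs
    have hk' : 2 * ((k:ℝ) + 1) ≤ m := by exact_mod_cast hk
    have hy : ((k+1:ℕ):ℝ)/m ≤ 1/2 := by
      rw [div_le_div_iff₀ hm' (by norm_num)]; push_cast; linarith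
    have hf := aux_f_pos β s hβ (le_trans (by positivity) hs.1) (hs.2.trans hy)
    have h := aux_step β hβ K hK m k hm hk s hs
    rw [← hE, ← hE, abs_le] at h
    have e1 : (K:ℝ) * (k+1:ℕ) / m = K * k / m + K / m := by push_cast; ring
    have e2 : fIsing β s = Real.exp (Real.log (fIsing β s)) := (Real.exp_log hf).symm
    rw [e2, ← Real.exp_add, ← Real.exp_add, Real.exp_le_exp, Real.exp_le_exp, e1]
    constructor <;> linarith [h.1, h.2]
  have hE0 : E 0 = 0 := by simp [hE]
  have hf0 : fIsing β 0 = Real.exp (-2*β) := by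
    have hc := Real.exp_pos (-2*β)
    unfold fIsing
    have : 1 + (Real.exp (-2*β)^2 - 1) * (1 - 2*0)^2 = Real.exp (-2*β)^2 := by ring
    rw [this, Real.sqrt_sq hc.le]; ring
  induction k using Nat.strong_induction_on with
  | _ k ih =>
  match k with
  | 0 => intro _; simp [hE0, gAux]
  | 1 =>
    intro h1
    have h := key 0 (by omega) 0 ⟨by simp, by positivity⟩
    rw [hf0, hE0] at h
    simp only [gAux]
    simp at h ⊢
    exact h.symm
  | k+2 =>
    intro h2
    obtain ⟨l1, u1⟩ := ih (k+1) (by omega) (by omega)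
    obtain ⟨l0, u0⟩ := ih k (by omega) (by omega)
    have h2' : 2 * ((k:ℝ) + 2) ≤ m := by exact_mod_cast h2
    set s : ℝ := ((k+1:ℕ):ℝ)/m with hs
    have hs0 : 0 ≤ s := by positivity
    have hs1 : s ≤ 1/2 := by
      rw [hs, div_le_div_iff₀ hm' (by norm_num)]; push_cast; linarith
    have hle0 : (k:ℝ)/m ≤ s := by rw [hs]; gcongr; simp
    have hle1 : s ≤ ((k+1+1:ℕ):ℝ)/m := by rw [hs]; gcongr; simp
    obtain ⟨p1, p2⟩ := key (k+1) (by omega) s ⟨le_rfl, hle1⟩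
    obtain ⟨q1, q2⟩ := key k (by omega) s ⟨hle0, le_rfl⟩
    have hf := aux_f_pos β s hβ hs0 hs1
    have hq := aux_f_quad β s hβ hs0 hs1
    have hA : (((m:ℝ) - 2*((k:ℝ)+2) + 2) * Real.exp (-2*β) / ((m:ℝ) - ((k:ℝ)+2) + 1))
        = (1 - 2*s) * Real.exp (-2*β) / (1 - s) := by
      have : (m:ℝ) - ((k:ℝ)+2) + 1 ≠ 0 := by linarith
      have h3 : 1 - s ≠ 0 := by linarith
      rw [div_eq_div_iff this h3, hs]; push_cast; field_simp; ring
    have hB : (((k:ℝ)+1) / ((m:ℝ) - ((k:ℝ)+2) + 1)) = s / (1 - s) := by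
      have : (m:ℝ) - ((k:ℝ)+2) + 1 ≠ 0 := by linarith
      have h3 : 1 - s ≠ 0 := by linarith
      rw [div_eq_div_iff this h3, hs]; push_cast; field_simp; ring
    have hA0 : 0 ≤ (1 - 2*s) * Real.exp (-2*β) / (1 - s) :=
      div_nonneg (mul_nonneg (by linarith) (Real.exp_pos _).le) (by linarith)
    have hB0 : 0 ≤ s / (1 - s) := div_nonneg hs0 (by linarith)
    simp only [gAux]
    rw [hA, hB]
    set A := (1 - 2*s) * Real.exp (-2*β) / (1 - s)
    set B := s / (1 - s)
    have hfA : fIsing β s = A + B / fIsing β s := by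
      field_simp; linarith
    have hD : 0 ≤ B / fIsing β s := div_nonneg hB0 hf.le
    have hDB : B / fIsing β s * fIsing β s = B := by field_simp
    set D := B / fIsing β s
    set f := fIsing β s
    constructor
    · refine p2.trans ?_
      have := mul_le_mul_of_nonneg_left l1 hA0
      have := mul_le_mul_of_nonneg_left l0 hB0
      have h5 := mul_le_mul_of_nonneg_left q2 hD
      rw [← mul_assoc, hDB] at h5
      rw [hfA, add_mul]
      linarith
    · refine le_trans ?_ p1
      have := mul_le_mul_of_nonneg_left u1 hA0
      have := mul_le_mul_of_nonneg_left u0 hB0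
      have h5 := mul_le_mul_of_nonneg_left q1 hD
      rw [← mul_assoc, hDB] at h5
      rw [hfA, add_mul]
      linarith

/-- Key lemma, part (ii): uniform approximation
`(1/m) log g(β,k,m) ≈ F(β,k/m)` with error `C/m`. -/
theorem g_F_uniform_approx (β : ℝ) (hβ : 0 ≤ β) :
    ∃ C : ℝ, 0 < C ∧ ∀ᶠ m : ℕ in Filter.atTop, ∀ k : ℕ, k ≤ m →
      |(1/(m:ℝ)) * Real.log (gIsing β k m) - FIsing β ((k:ℝ)/(m:ℝ))| ≤ C / (m:ℝ) := by
  obtain ⟨K, hK⟩ := aux_lip β hβ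
  refine ⟨K + 1, by positivity, ?_⟩
  filter_upwards [eventually_gt_atTop 0] with m hm k hk
  have hm' : (0:ℝ) < m := by exact_mod_cast hm
  have main : ∀ j : ℕ, 2 * j ≤ m → |(1/(m:ℝ)) * Real.log (gAux β m j)
      - ∫ u in (0:ℝ)..((j:ℝ)/m), Real.log (fIsing β u)| ≤ (K + 1) / (m:ℝ) := by
    intro j hj
    obtain ⟨l, u⟩ := aux_main β hβ K hK m hm _ (fun _ => rfl) j hj
    have hg := lt_of_lt_of_le (Real.exp_pos _) l
    rw [← Real.le_log_iff_exp_le hg] at l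
    rw [← Real.log_le_iff_le_exp hg] at u
    have hj' : (j:ℝ) ≤ m := by exact_mod_cast (by omega : j ≤ m)
    have hb : (K:ℝ) * j / m ≤ K := by
      rw [div_le_iff₀ hm']
      exact mul_le_mul_of_nonneg_left hj' K.2
    set I := ∫ u in (0:ℝ)..((j:ℝ)/m), Real.log (fIsing β u)
    have e : (1/(m:ℝ)) * Real.log (gAux β m j) - I = (Real.log (gAux β m j) - m * I) / m := by
      field_simp
    rw [e, abs_div, abs_of_pos hm']
    gcongr
    rw [abs_le]
    constructor <;> linarith
  unfold gIsing FIsing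
  split_ifs with h
  · have h2 : 2 * k ≤ m := by omega
    have h2' : 2 * (k:ℝ) ≤ m := by exact_mod_cast h2
    have h3 : (k:ℝ)/m ≤ 1/2 := by rw [div_le_div_iff₀ hm' (by norm_num)]; linarith
    rw [min_eq_left (by linarith)]
    exact main k h2
  · have h2 : 2 * (m - k) ≤ m := by omega
    have h2' : (m:ℝ) ≤ 2 * (k:ℝ) := by exact_mod_cast (by omega : m ≤ 2 * k)
    have h3 : 1/2 ≤ (k:ℝ)/m := by rw [div_le_div_iff₀ (by norm_num) hm']; linarith
    have h4 : 1 - (k:ℝ)/m = ((m-k:ℕ):ℝ)/m := by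
      rw [Nat.cast_sub hk]; field_simp
    rw [min_eq_right (by linarith), h4]
    exact main (m-k) h2
end

section
/- For every β > 0 and every t ∈ [0,1/2], one has c ≤ f(β,t) ≤ 1; moreover f(β,·) is strictly increasing on [0,1/2], with f(β,0) = c and f(β,1/2) = 1. -/
open Filter MeasureTheory

lemma fIsing_pos_quad (β t : ℝ) (hβ : 0 < β) (h0 : 0 ≤ t) (h1 : t ≤ 1/2) :
    0 < fIsing β t ∧
    (1-t) * fIsing β t ^ 2 - Real.exp (-2*β) * (1-2*t) * fIsing β t - t = 0 := by
  have hc : 0 < Real.exp (-2*β) := Real.exp_pos _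
  unfold fIsing
  generalize Real.exp (-2*β) = c at hc
  have hX : 0 < 1 + (c^2 - 1) * (1 - 2*t)^2 := by
    rcases h0.eq_or_lt with h | h
    · subst h; nlinarith [sq_nonneg c, mul_pos hc hc]
    · nlinarith [mul_nonneg (sq_nonneg c) (sq_nonneg (1-2*t)), mul_pos h (show 0 < 1 - t by linarith)]
  have hS := Real.sqrt_pos.2 hX
  have hS2 := Real.sq_sqrt hX.le
  generalize Real.sqrt (1 + (c^2 - 1) * (1 - 2*t)^2) = S at hS hS2
  have h3 : 0 < 1 - t := by linarith
  constructor
  · have : 0 ≤ c * (1-2*t) := mul_nonneg hc.le (by linarith)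
    positivity
  · have h4 : (1 - t) ≠ 0 := h3.ne'
    field_simp
    linear_combination hS2

/-- bounds and monotonicity of `f(β,·)` on `[0,1/2]`. -/
theorem fIsing_bounds_and_mono (β : ℝ) (hβ : 0 < β) :
    (∀ t ∈ Set.Icc (0:ℝ) (1/2),
      Real.exp (-2*β) ≤ fIsing β t ∧ fIsing β t ≤ 1) ∧
    StrictMonoOn (fIsing β) (Set.Icc (0:ℝ) (1/2)) ∧
    fIsing β 0 = Real.exp (-2*β) ∧
    fIsing β (1/2) = 1 := by
  have hc : 0 < Real.exp (-2*β) := Real.exp_pos _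
  have hc1 : Real.exp (-2*β) < 1 := Real.exp_lt_one_iff.2 (by linarith)
  have hm : StrictMonoOn (fIsing β) (Set.Icc (0:ℝ) (1/2)) := by
    rintro s ⟨hs0, hs1⟩ t ⟨ht0, ht1⟩ hst
    obtain ⟨hx, hxq⟩ := fIsing_pos_quad β s hβ hs0 hs1
    obtain ⟨hy, hyq⟩ := fIsing_pos_quad β t hβ ht0 ht1
    generalize fIsing β s = x at *
    generalize fIsing β t = y at *
    generalize Real.exp (-2*β) = c at *
    by_contra! hyx
    have h1 : 0 < x^2 - 2*c*x + 1 := by nlinarith [sq_nonneg (x-c)]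
    have h2 : (1-t)*x^2 - c*(1-2*t)*x - t < 0 := by
      nlinarith [mul_pos (sub_pos.2 hst) h1]
    have h3 : 0 ≤ (1-t)*y - c*(1-2*t) := by
      by_contra! h
      nlinarith [mul_pos hy (neg_pos.2 h)]
    have h4 : 0 ≤ (1-t)*x := mul_nonneg (by linarith) hx.le
    nlinarith [mul_nonneg (sub_nonneg.2 hyx) (add_nonneg h3 h4)]
  have e0 : fIsing β 0 = Real.exp (-2*β) := by
    have h : 1 + (Real.exp (-2*β)^2 - 1) * (1 - 2*0)^2 = Real.exp (-2*β)^2 := by ring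
    rw [fIsing, h, Real.sqrt_sq hc.le]
    ring
  have e1 : fIsing β (1/2) = 1 := by
    norm_num [fIsing]
  refine ⟨fun t ht => ⟨?_, ?_⟩, hm, e0, e1⟩
  · rw [← e0]
    exact hm.monotoneOn ⟨le_rfl, by norm_num⟩ ht ht.1
  · rw [← e1]
    exact hm.monotoneOn ht ⟨by norm_num, le_rfl⟩ ht.2
end

section
/- For every β > 0 there exists a constant κ = κ(β) > 0 such that for every integer m ≥ 2 and every integer k with 1 ≤ k ≤ ⌊m/2⌋, the recursively defined sequence h satisfies | h(k,m) − f(β,(k−1)/m) | ≤ κ/m. -/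
open Filter MeasureTheory

/-- The sequence `h(·,m)`: `h(1,m) = c` and
`h(k+1,m) = c(m−2k)/(m−k) + k/((m−k) h(k,m))`. -/
noncomputable def hseq (β : ℝ) (m : ℕ) : ℕ → ℝ
  | 0 => 1
  | 1 => Real.exp (-2*β)
  | (k+2) => Real.exp (-2*β) * ((m:ℝ) - 2*((k:ℝ)+1)) / ((m:ℝ) - ((k:ℝ)+1))
      + ((k:ℝ)+1) / (((m:ℝ) - ((k:ℝ)+1)) * hseq β m (k+1))

/-- The point `(t, f)` lies on the positive branch of the fixed point equation. -/
structure IsBranch (c t f : ℝ) : Prop where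
  t0 : 0 ≤ t
  t1 : t ≤ 1/2
  lo : c ≤ f
  hi : f ≤ 1
  eq : (1-t)*f^2 - c*(1-2*t)*f - t = 0

/-- The discriminant root, as a function of the branch point. -/
noncomputable def branchS (c t f : ℝ) : ℝ := 2*(1-t)*f - c*(1-2*t)

/-- The first order correction. -/
noncomputable def branchG (c t f : ℝ) : ℝ := (1-2*c*f+f^2)*((1-t)*f)/(branchS c t f)^2

theorem isBranch_fIsing (β t : ℝ) (hβ : 0 < β) (h0 : 0 ≤ t) (h1 : t ≤ 1/2) :
    IsBranch (Real.exp (-2*β)) t (fIsing β t) := by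
  have hc : 0 < Real.exp (-2*β) := Real.exp_pos _
  have hc1 : Real.exp (-2*β) < 1 := by rw [Real.exp_lt_one_iff]; linarith
  unfold fIsing
  generalize Real.exp (-2*β) = c at *
  have hx : (1-2*t)^2 ≤ 1 := by nlinarith
  have hn : 0 ≤ 1 + (c^2-1)*(1-2*t)^2 := by nlinarith [sq_nonneg (c*(1-2*t))]
  have hs := Real.sq_sqrt hn
  have hs0 := Real.sqrt_nonneg (1 + (c^2-1)*(1-2*t)^2)
  generalize Real.sqrt (1 + (c^2-1)*(1-2*t)^2) = s at *
  have ht : 0 < 1 - t := by linarith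
  refine ⟨h0, h1, ?_, ?_, ?_⟩
  · rw [le_div_iff₀ (by linarith)]
    have : c ≤ s := by
      refine (abs_le_of_sq_le_sq' ?_ hs0).2
      nlinarith [mul_nonneg (by nlinarith : 0 ≤ 1 - c^2) (by linarith : 0 ≤ 1 - (1-2*t)^2)]
    linarith
  · rw [div_le_one (by linarith)]
    have : s ≤ 2*(1-t) - c*(1-2*t) := by
      refine (abs_le_of_sq_le_sq' ?_ ?_).2
      · nlinarith [mul_nonneg (by linarith : 0 ≤ 1 - c) (by linarith : 0 ≤ 1-2*t), mul_nonneg (mul_nonneg (by linarith : 0 ≤ 1 - c) (by linarith : 0 ≤ 1-2*t)) ht.le]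
      · nlinarith [mul_nonneg (by linarith : 0 ≤ 1 - c) (by linarith : 0 ≤ 1-2*t)]
    linarith
  · field_simp
    nlinarith [hs]

section
variable {c t f t' f' : ℝ}

theorem branch_pos (hc : 0 < c) (h : IsBranch c t f) :
    0 ≤ (1-t)*f - c*(1-2*t) := by
  have hf : 0 < f := lt_of_lt_of_le hc h.lo
  have : 0 ≤ ((1-t)*f - c*(1-2*t))*f := by nlinarith [h.eq, h.t0]
  exact nonneg_of_mul_nonneg_left this hf

theorem branchS_lo (hc : 0 < c) (h : IsBranch c t f) : c/2 ≤ branchS c t f := by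
  unfold branchS
  have := branch_pos hc h
  nlinarith [h.t0, h.t1, h.lo]

theorem branchS_hi (hc : 0 < c) (h : IsBranch c t f) : branchS c t f ≤ 2 := by
  unfold branchS
  have hf : 0 < f := lt_of_lt_of_le hc h.lo
  nlinarith [h.t0, h.t1, h.hi, mul_nonneg hc.le (by linarith [h.t1] : 0 ≤ 1-2*t), mul_nonneg h.t0 hf.le]

theorem branchN_bd (hc : 0 < c) (hc1 : c < 1) (h : IsBranch c t f) :
    0 ≤ 1-2*c*f+f^2 ∧ 1-2*c*f+f^2 ≤ 2 := by
  have hf : 0 < f := lt_of_lt_of_le hc h.lo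
  constructor
  · nlinarith [sq_nonneg (1-f), mul_pos hc hf]
  · nlinarith [mul_pos hc hf, h.hi]

theorem branch_key (h : IsBranch c t f) (h' : IsBranch c t' f') :
    (f'-f)*((1-t')*(f+f') - c*(1-2*t')) = (t'-t)*(1-2*c*f+f^2) := by
  linear_combination h'.eq - h.eq

theorem branchK_lo (hc : 0 < c) (h : IsBranch c t f) (h' : IsBranch c t' f') :
    c/2 ≤ (1-t')*(f+f') - c*(1-2*t') := by
  have := branch_pos hc h'
  nlinarith [h'.t1, h.lo, mul_nonneg (by linarith [h'.t1] : 0 ≤ 1/2-t') (by linarith [h.lo] : 0 ≤ f)]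

theorem branch_lip (hc : 0 < c) (hc1 : c < 1) (h : IsBranch c t f) (h' : IsBranch c t' f') :
    |f'-f| ≤ 4/c*|t'-t| := by
  have hk := branch_key h h'
  have hK := branchK_lo hc h h'
  obtain ⟨hN0, hN⟩ := branchN_bd hc hc1 h
  set K := (1-t')*(f+f') - c*(1-2*t')
  have h2 : |f'-f| * K = |t'-t| * (1-2*c*f+f^2) := by
    have := congrArg abs hk
    rwa [abs_mul, abs_mul, abs_of_nonneg (by linarith : 0 ≤ K), abs_of_nonneg hN0] at this
  rw [div_mul_eq_mul_div, le_div_iff₀ hc]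
  nlinarith [abs_nonneg (f'-f), abs_nonneg (t'-t), mul_le_mul_of_nonneg_left hK (abs_nonneg (f'-f)), mul_le_mul_of_nonneg_left hN (abs_nonneg (t'-t))]

theorem one_le_div_c (hc : 0 < c) (hc1 : c < 1) : 1 ≤ 1/c := by
  rw [le_div_iff₀ hc]; linarith

theorem branch_second (hc : 0 < c) (hc1 : c < 1) (h : IsBranch c t f) (h' : IsBranch c t' f') :
    |f'-f-(t'-t)*((1-2*c*f+f^2)/branchS c t f)| ≤ 48/c^3*|t'-t|^2 := by
  have hk := branch_key h h'
  have hK := branchK_lo hc h h'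
  obtain ⟨hN0, hN⟩ := branchN_bd hc hc1 h
  have hS := branchS_lo hc h
  have hl := branch_lip hc hc1 h h'
  have hKS : branchS c t f - ((1-t')*(f+f') - c*(1-2*t')) = (t'-t)*(2*(f-c)) - (1-t')*(f'-f) := by
    unfold branchS; ring
  set K := (1-t')*(f+f') - c*(1-2*t')
  set S := branchS c t f
  set N := 1-2*c*f+f^2
  have hK0 : 0 < K := by linarith
  have hS0 : 0 < S := by linarith
  have hd : |S-K| ≤ 6/c*|t'-t| := by
    rw [hKS]
    have e1 : |(t'-t)*(2*(f-c))| ≤ |t'-t| * 2 := by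
      rw [abs_mul]
      gcongr
      rw [abs_of_nonneg (by linarith [h.lo])]; linarith [h.hi]
    have e2 : |(1-t')*(f'-f)| ≤ 1*|f'-f| := by
      rw [abs_mul]
      gcongr
      rw [abs_of_nonneg (by linarith [h'.t1])]; linarith [h'.t0]
    have e3 := abs_sub ((t'-t)*(2*(f-c))) ((1-t')*(f'-f))
    have e4 : |t'-t| * 2 ≤ 2/c*|t'-t| := by
      have := mul_le_mul_of_nonneg_right (one_le_div_c hc hc1) (abs_nonneg (t'-t))
      have e : 2/c*|t'-t| = 2*(1/c*|t'-t|) := by ring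
      linarith
    have e5 : 6/c*|t'-t| = 2/c*|t'-t| + 4/c*|t'-t| := by ring
    linarith
  have hv : f'-f = (t'-t)*N/K := by rw [eq_div_iff hK0.ne']; exact hk
  have e : f'-f-(t'-t)*(N/S) = (t'-t)*N*(S-K)/(K*S) := by
    rw [hv]; field_simp
  rw [e, abs_div, abs_mul, abs_mul, abs_of_nonneg hN0, abs_of_pos (mul_pos hK0 hS0)]
  calc |t'-t| * N*|S-K|/(K*S) ≤ |t'-t| * 2*(6/c*|t'-t|)/(c/2*(c/2)) := by gcongr
    _ = 48/c^3*|t'-t|^2 := by field_simp; ring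

theorem branchG_bd (hc : 0 < c) (hc1 : c < 1) (h : IsBranch c t f) :
    0 ≤ branchG c t f ∧ branchG c t f ≤ 8/c^2 := by
  obtain ⟨hN0, hN⟩ := branchN_bd hc hc1 h
  have hS := branchS_lo hc h
  have hf : 0 < f := lt_of_lt_of_le hc h.lo
  have ht : 0 ≤ 1-t := by linarith [h.t1]
  have h2 : (1-t)*f ≤ 1 := by nlinarith [h.t0, h.hi]
  unfold branchG
  constructor
  · positivity
  · calc _ ≤ 2*1/(c/2)^2 := by gcongr
      _ = 8/c^2 := by field_simp; ring

theorem abs_prod_sub_le {a b a' b' A B : ℝ} (ha : |a| ≤ A) (hb : |b'| ≤ B) :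
    |a'*b'-a*b| ≤ |a'-a| * B + A*|b'-b| := by
  have e : a'*b'-a*b = (a'-a)*b' + a*(b'-b) := by ring
  rw [e]
  refine (abs_add_le _ _).trans ?_
  rw [abs_mul, abs_mul]
  gcongr

theorem branchG_lip (hc : 0 < c) (hc1 : c < 1) (h : IsBranch c t f) (h' : IsBranch c t' f') :
    |branchG c t' f' - branchG c t f| ≤ 3200/c^5*|t'-t| := by
  have hl := branch_lip hc hc1 h h'
  have hf : 0 < f := lt_of_lt_of_le hc h.lo
  have hf' : 0 < f' := lt_of_lt_of_le hc h'.lo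
  obtain ⟨hN0, hN⟩ := branchN_bd hc hc1 h
  obtain ⟨hN0', hN'⟩ := branchN_bd hc hc1 h'
  have hS := branchS_lo hc h
  have hS' := branchS_lo hc h'
  have hSu := branchS_hi hc h
  have hSu' := branchS_hi hc h'
  have hu : |t'-t| ≤ 1/c*|t'-t| := by
    have := mul_le_mul_of_nonneg_right (one_le_div_c hc hc1) (abs_nonneg (t'-t))
    linarith
  have hl2 : |f'-f| ≤ 4*(1/c*|t'-t|) := by
    have : 4/c*|t'-t| = 4*(1/c*|t'-t|) := by ring
    linarith
  set w := 1/c*|t'-t| with hw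
  have hq : |(1-t')*f' - (1-t)*f| ≤ 5*w := by
    have := @abs_prod_sub_le (1-t) f (1-t') f' 1 1
      (by rw [abs_of_nonneg] <;> linarith [h.t0, h.t1]) (by rw [abs_of_pos hf']; exact h'.hi)
    have e : |1-t'-(1-t)| = |t'-t| := by rw [← abs_neg]; congr 1; ring
    rw [e] at this
    linarith
  have hn : |(1-2*c*f'+f'^2) - (1-2*c*f+f^2)| ≤ 16*w := by
    have e : (1-2*c*f'+f'^2) - (1-2*c*f+f^2) = (f'-f)*(f+f'-2*c) := by ring
    rw [e, abs_mul]
    have : |f+f'-2*c| ≤ 2 := by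
      rw [abs_of_nonneg] <;> linarith [h.lo, h'.lo, h.hi, h'.hi]
    nlinarith [abs_nonneg (f'-f), mul_le_mul_of_nonneg_left this (abs_nonneg (f'-f)), abs_nonneg (t'-t)]
  have hs : |branchS c t' f' - branchS c t f| ≤ 12*w := by
    have e : branchS c t' f' - branchS c t f = 2*((1-t')*f' - (1-t)*f) + 2*c*(t'-t) := by
      unfold branchS; ring
    rw [e]
    refine (abs_add_le _ _).trans ?_
    rw [abs_mul, abs_mul, abs_of_pos (by norm_num : (0:ℝ) < 2), abs_of_pos (by linarith : 0 < 2*c)]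
    nlinarith [abs_nonneg (t'-t)]
  have hm : |(1-2*c*f'+f'^2)*((1-t')*f') - (1-2*c*f+f^2)*((1-t)*f)| ≤ 26*w := by
    have := @abs_prod_sub_le (1-2*c*f+f^2) ((1-t)*f) (1-2*c*f'+f'^2) ((1-t')*f') 2 1
      (by rw [abs_of_nonneg hN0]; exact hN)
      (by rw [abs_of_nonneg (mul_nonneg (by linarith [h'.t1]) hf'.le)]; nlinarith [h'.t0, h'.hi])
    linarith
  have hM0 : 0 ≤ (1-2*c*f+f^2)*((1-t)*f) := 
    mul_nonneg hN0 (mul_nonneg (by linarith [h.t1]) hf.le)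
  have hM2 : (1-2*c*f+f^2)*((1-t)*f) ≤ 2 := by
    have h2 : (1-t)*f ≤ 1 := by nlinarith [h.t0, h.hi]
    have h3 : 0 ≤ (1-t)*f := mul_nonneg (by linarith [h.t1]) hf.le
    nlinarith
  unfold branchG
  set M := (1-2*c*f+f^2)*((1-t)*f)
  set M' := (1-2*c*f'+f'^2)*((1-t')*f')
  set S := branchS c t f
  set S' := branchS c t' f'
  have hS0 : 0 < S := by linarith
  have hS0' : 0 < S' := by linarith
  have e : M'/S'^2 - M/S^2 = (M'*S^2 - M*S'^2)/(S'^2*S^2) := by field_simp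
  have hsq : |S^2 - S'^2| ≤ 48*w := by
    have e : S^2 - S'^2 = (S+S')*-(S'-S) := by ring
    rw [e, abs_mul, abs_neg, abs_of_pos (by linarith)]
    nlinarith [abs_nonneg (S'-S)]
  have hnum : |M'*S^2 - M*S'^2| ≤ 200*w := by
    have := @abs_prod_sub_le M (S'^2) M' (S^2) 2 4 (by rwa [abs_of_nonneg hM0])
      (by rw [abs_of_nonneg (sq_nonneg _)]; nlinarith)
    linarith
  rw [e, abs_div, abs_of_pos (by positivity : 0 < S'^2*S^2)]
  calc |M'*S^2 - M*S'^2|/(S'^2*S^2) ≤ 200*w/((c/2)^2*(c/2)^2) := by gcongr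
    _ = 3200/c^5*|t'-t| := by rw [hw]; field_simp; ring

/-- The corrected approximate solution. -/
noncomputable def branchB (c u t f : ℝ) : ℝ := f^2/(f+branchG c t f*u)

theorem branchB_pos {u : ℝ} (hc : 0 < c) (hc1 : c < 1) (hu : 0 ≤ u) (h : IsBranch c t f) :
    0 < branchB c u t f := by
  have hf : 0 < f := lt_of_lt_of_le hc h.lo
  have := (branchG_bd hc hc1 h).1
  unfold branchB
  positivity

theorem branchB_near {u : ℝ} (hc : 0 < c) (hc1 : c < 1) (hu : 0 ≤ u) (h : IsBranch c t f) :
    |branchB c u t f - f| ≤ 8/c^2*u := by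
  have hf : 0 < f := lt_of_lt_of_le hc h.lo
  obtain ⟨h0, h1⟩ := branchG_bd hc hc1 h
  unfold branchB
  set G := branchG c t f
  have hp : 0 < f+G*u := by positivity
  have e : f^2/(f+G*u) - f = -(f*(G*u)/(f+G*u)) := by field_simp; ring
  rw [e, abs_neg, abs_of_nonneg (by positivity)]
  refine le_trans ?_ (mul_le_mul_of_nonneg_right h1 hu)
  rw [div_le_iff₀ hp]
  have : 0 ≤ G*u := by positivity
  nlinarith

/-- Error constant of the approximate solution. -/
noncomputable def errE (c : ℝ) : ℝ := 48/c^3 + 3200/c^5 + 64/c^5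

theorem branchB_step {u : ℝ} (hc : 0 < c) (hc1 : c < 1) (hu : 0 ≤ u) (h : IsBranch c t f)
    (h' : IsBranch c t' f') (htu : t' - t = u) :
    |c*(1-2*t)/(1-t) + t/(1-t)/branchB c u t f - branchB c u t' f'| ≤ errE c*u^2 := by
  have hf : 0 < f := lt_of_lt_of_le hc h.lo
  have hf' : 0 < f' := lt_of_lt_of_le hc h'.lo
  have ht : 0 < 1-t := by linarith [h.t1]
  have h2 := branch_second hc hc1 h h'
  have h3 := branchG_lip hc hc1 h h'
  obtain ⟨g0, g1⟩ := branchG_bd hc hc1 h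
  obtain ⟨g0', g1'⟩ := branchG_bd hc hc1 h'
  have hS : 0 < branchS c t f := by linarith [branchS_lo hc h]
  rw [htu, abs_of_nonneg hu] at h2 h3
  have hrel : t/(1-t)*branchG c t f/f^2 = (1-2*c*f+f^2)/branchS c t f - branchG c t f := by
    have hSf : f*branchS c t f = (1-t)*f^2 + t := by
      unfold branchS; linear_combination h.eq
    unfold branchG
    set S := branchS c t f
    field_simp
    linear_combination (-(1-2*c*f+f^2))*hSf
  have hfix : c*(1-2*t)/(1-t) + t/(1-t)/f = f := by
    field_simp
    linear_combination -h.eq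
  unfold branchB
  set G := branchG c t f
  set G' := branchG c t' f'
  set p := (1-2*c*f+f^2)/branchS c t f
  have e1 : t/(1-t)/(f^2/(f+G*u)) = t/(1-t)/f + t/(1-t)*G/f^2*u := by
    field_simp
  have hp : 0 < f'+G'*u := by positivity
  have e2 : f'^2/(f'+G'*u) = f' - G'*u + (G'*u)^2/(f'+G'*u) := by field_simp; ring
  have e : c*(1-2*t)/(1-t) + t/(1-t)/(f^2/(f+G*u)) - f'^2/(f'+G'*u)
      = -(f'-f-u*p) + (G'-G)*u - (G'*u)^2/(f'+G'*u) := by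
    rw [e1, e2, hrel]
    linear_combination hfix
  have hx : (G'*u)^2/(f'+G'*u) ≤ 64/c^5*u^2 := by
    have hcl : c ≤ f'+G'*u := by have : 0 ≤ G'*u := by positivity
                                 linarith [h'.lo]
    calc (G'*u)^2/(f'+G'*u) ≤ (8/c^2*u)^2/c := by gcongr
      _ = 64/c^5*u^2 := by field_simp; ring
  rw [e]
  have a1 := abs_sub (-(f'-f-u*p) + (G'-G)*u) ((G'*u)^2/(f'+G'*u))
  have a2 := abs_add_le (-(f'-f-u*p)) ((G'-G)*u)
  rw [abs_neg] at a2
  rw [abs_mul, abs_of_nonneg hu] at a2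
  rw [abs_of_nonneg (by positivity : 0 ≤ (G'*u)^2/(f'+G'*u))] at a1
  have a3 : |G'-G| * u ≤ 3200/c^5*u*u := by gcongr
  unfold errE
  linarith

/-- Two consecutive linearised steps are almost contracting. -/
theorem branchB_prod {u : ℝ} (hc : 0 < c) (hc1 : c < 1) (hu : 0 ≤ u) (h : IsBranch c t f)
    (h' : IsBranch c t' f') (htu : t' - t = u) :
    t'/(1-t')/(branchB c u t f*branchB c u t' f') ≤ (1+12/c^3*u)^2 := by
  have hf : 0 < f := lt_of_lt_of_le hc h.lo
  have hf' : 0 < f' := lt_of_lt_of_le hc h'.lo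
  have ht' : 0 < 1-t' := by linarith [h'.t1]
  obtain ⟨g0, g1⟩ := branchG_bd hc hc1 h
  obtain ⟨g0', g1'⟩ := branchG_bd hc hc1 h'
  have hl := branch_lip hc hc1 h h'
  rw [htu, abs_of_nonneg hu] at hl
  have hl := (abs_le.1 hl).2
  have htau : t'/(1-t') ≤ f'^2 := by
    rw [div_le_iff₀ ht']
    nlinarith [h'.eq, mul_nonneg (mul_nonneg hc.le (by linarith [h'.t1] : 0 ≤ 1-2*t')) hf'.le]
  have c3 : 1/c^2 ≤ 1/c^3 := by
    apply one_div_le_one_div_of_le (by positivity)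
    nlinarith [sq_nonneg c]
  have c2 : 1/c ≤ 1/c^2 := by
    apply one_div_le_one_div_of_le (by positivity)
    nlinarith
  unfold branchB
  set G := branchG c t f
  set G' := branchG c t' f'
  have hB : 12/c^2*u ≤ 12/c^3*u*f := by
    calc 12/c^2*u = 12/c^3*u*c := by field_simp
      _ ≤ 12/c^3*u*f := by gcongr; exact h.lo
  have hw : 4/c*u + 8/c^2*u ≤ 12/c^2*u := by
    have : (4/c+8/c^2)*u ≤ (12/c^2)*u := by
      gcongr
      have e1 : 4/c = 4*(1/c) := by ring
      have e2 : 8/c^2 = 8*(1/c^2) := by ring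
      have e3 : 12/c^2 = 12*(1/c^2) := by ring
      rw [e1, e2, e3]; linarith
    linarith
  have q1 : G*u ≤ 8/c^2*u := by gcongr
  have q2 : G'*u ≤ 8/c^2*u := by gcongr
  have q0 : 0 ≤ 4/c*u := by positivity
  have y1 : (f+G*u)/f ≤ 1+12/c^3*u := by
    rw [div_le_iff₀ hf]; linarith
  have y2 : (f'+G'*u)/f ≤ 1+12/c^3*u := by
    rw [div_le_iff₀ hf]; linarith
  calc t'/(1-t')/(f^2/(f+G*u)*(f'^2/(f'+G'*u))) ≤ f'^2/(f^2/(f+G*u)*(f'^2/(f'+G'*u))) := by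
        gcongr
    _ = (f+G*u)/f*((f'+G'*u)/f) := by field_simp
    _ ≤ (1+12/c^3*u)*(1+12/c^3*u) := by gcongr
    _ = _ := by ring

theorem branchB_inv {u : ℝ} (hc : 0 < c) (hc1 : c < 1) (hu : 0 ≤ u) (hu1 : u ≤ 1)
    (h : IsBranch c t f) : c^2/(1+8/c^2) ≤ branchB c u t f := by
  have hf : 0 < f := lt_of_lt_of_le hc h.lo
  obtain ⟨g0, g1⟩ := branchG_bd hc hc1 h
  unfold branchB
  have : branchG c t f*u ≤ 8/c^2*1 := by gcongr
  have h1 := h.hi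
  have h2 := h.lo
  have : f + branchG c t f*u ≤ 1+8/c^2 := by linarith
  gcongr

end

theorem two_step_gronwall (d : ℕ → ℝ) (n : ℕ) (l D E : ℝ) (hl : 1 ≤ l) (hE : 0 ≤ E) (hD : 0 ≤ D)
    (h1 : 1 ≤ n → d 1 ≤ D) (h2 : 2 ≤ n → d 2 ≤ D)
    (hs : ∀ k, 1 ≤ k → k+2 ≤ n → d (k+2) ≤ l*d k + E) :
    ∀ k, 1 ≤ k → k ≤ n → d k ≤ l^k*(D+k*E) := by
  intro k
  induction k using Nat.strong_induction_on with
  | _ k ih =>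
    intro hk hkn
    have hbase : D ≤ l^k*(D+k*E) := by
      have a := one_le_pow₀ hl (n := k)
      have b : 0 ≤ (k:ℝ)*E := by positivity
      nlinarith
    match k, hk with
    | 1, _ => exact (h1 hkn).trans hbase
    | 2, _ => exact (h2 hkn).trans hbase
    | j+3, _ =>
      have a := ih (j+1) (by omega) (by omega) (by omega)
      have b := hs (j+1) (by omega) (by omega)
      have hl0 : 0 ≤ l := by linarith
      have e : l*(l^(j+1)*(D+((j+1:ℕ):ℝ)*E)) ≤ l^(j+3)*(D+((j+1:ℕ):ℝ)*E) := by
        rw [← mul_assoc, ← pow_succ']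
        exact mul_le_mul_of_nonneg_right (pow_le_pow_right₀ hl (by omega)) (by positivity)
      have e2 : E ≤ l^(j+3)*E := by
        have := one_le_pow₀ hl (n := j+3)
        nlinarith
      have e3 : 0 ≤ l^(j+3)*E := by positivity
      have e4 := mul_le_mul_of_nonneg_left a hl0
      push_cast at *
      have e5 : l^(j+3)*(D+((j:ℝ)+3)*E) = l^(j+3)*(D+((j:ℝ)+1)*E) + l^(j+3)*E + l^(j+3)*E := by ring
      rw [e5]
      have : j+1+2 = j+3 := rfl
      rw [this] at b
      linarith

theorem hseq_step (β : ℝ) (m k : ℕ) (hk : 1 ≤ k) (hm : 0 < m) (hkm : k < m) :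
    hseq β m (k+1) = Real.exp (-2*β)*(1-2*((k:ℝ)/m))/(1-(k:ℝ)/m)
      + (k:ℝ)/m/(1-(k:ℝ)/m)/hseq β m k := by
  obtain ⟨j, rfl⟩ : ∃ j, k = j+1 := ⟨k-1, by omega⟩
  have hm' : (0:ℝ) < m := by exact_mod_cast hm
  have h3 : (0:ℝ) < (m:ℝ) - ((j:ℝ)+1) := by
    have : ((j+1:ℕ):ℝ) < m := by exact_mod_cast hkm
    push_cast at this; linarith
  rw [hseq]
  push_cast
  have e1 : 1-((j:ℝ)+1)/m = ((m:ℝ)-((j:ℝ)+1))/m := by field_simp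
  have e2 : 1-2*(((j:ℝ)+1)/m) = ((m:ℝ)-2*((j:ℝ)+1))/m := by field_simp
  rw [e1, e2, div_div_div_cancel_right₀ hm'.ne', mul_div_assoc', div_div_div_cancel_right₀ hm'.ne',
    div_div]

theorem hseq_bd (β : ℝ) (hβ : 0 < β) (m : ℕ) (k : ℕ) (hk : 1 ≤ k) (hkm : k ≤ m/2) :
    Real.exp (-2*β) ≤ hseq β m k ∧ hseq β m k ≤ 1/Real.exp (-2*β) := by
  have hc : 0 < Real.exp (-2*β) := Real.exp_pos _
  have hc1 : Real.exp (-2*β) < 1 := by rw [Real.exp_lt_one_iff]; linarith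
  have hci := one_le_div_c hc hc1
  induction k, hk using Nat.le_induction with
  | base => rw [hseq]; exact ⟨le_rfl, by linarith⟩
  | succ k hk ih =>
    obtain ⟨i1, i2⟩ := ih (by omega)
    have hm : 0 < m := by omega
    rw [hseq_step β m k hk hm (by omega)]
    have hm' : (0:ℝ) < m := by exact_mod_cast hm
    have ht0 : 0 ≤ (k:ℝ)/m := by positivity
    have ht1 : (k:ℝ)/m ≤ 1/2 := by
      rw [div_le_div_iff₀ hm' (by norm_num)]
      have : k*2 ≤ 1*m := by omega
      exact_mod_cast this
    generalize Real.exp (-2*β) = c at *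
    generalize (k:ℝ)/m = t at *
    generalize hseq β m k = y at *
    have hy : 0 < y := by linarith
    have ht : 0 < 1-t := by linarith
    have z1 : c ≤ 1/y := by rw [le_div_iff₀ hy]; rw [le_div_iff₀ hc] at i2; linarith
    have z2 : 1/y ≤ 1/c := one_div_le_one_div_of_le hc i1
    have e : c*(1-2*t)/(1-t) + t/(1-t)/y = (c*(1-2*t) + t*(1/y))/(1-t) := by field_simp
    rw [e, le_div_iff₀ ht, div_le_iff₀ ht]
    have z3 : 0 ≤ 1-2*t := by linarith
    constructor
    · nlinarith
    · nlinarith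

theorem hseq_approx_fIsing (β : ℝ) (hβ : 0 < β) :
    ∃ κ : ℝ, 0 < κ ∧ ∀ m : ℕ, 2 ≤ m → ∀ k : ℕ, 1 ≤ k → k ≤ m/2 →
      |hseq β m k - fIsing β (((k:ℝ) - 1)/(m:ℝ))| ≤ κ/(m:ℝ) := by
  have hc : 0 < Real.exp (-2*β) := Real.exp_pos _
  have hc1 : Real.exp (-2*β) < 1 := by rw [Real.exp_lt_one_iff]; linarith
  have hbr := fun t => isBranch_fIsing β t hβ
  have hst := hseq_step β
  have hbd := hseq_bd β hβ
  have hone : ∀ m, hseq β m 1 = Real.exp (-2*β) := fun m => by rw [hseq]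
  have hf0 : fIsing β 0 = Real.exp (-2*β) := by
    unfold fIsing
    have : (1 + (Real.exp (-2*β)^2 - 1) * (1 - 2*0)^2) = Real.exp (-2*β)^2 := by ring
    rw [this, Real.sqrt_sq hc.le]; ring
  generalize Real.exp (-2*β) = c at *
  have hE : 0 ≤ errE c := by unfold errE; positivity
  set E := errE c with hEdef
  set D1 := 4/c+8/c^2 with hD1
  have hD1p : 0 < D1 := by positivity
  set R := 1/(c*(c^2/(1+8/c^2))) with hR
  have hRp : 0 < R := by positivity
  set A := 12/c^3 with hA
  have hAp : 0 < A := by positivity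
  set D := (1+R)*D1+E with hD
  have hDp : 0 < D := by positivity
  refine ⟨Real.exp (2*A)*(D+(R+1)*E) + D1, by positivity, ?_⟩
  intro m hm2
  have hm : 0 < m := by omega
  have hm' : (0:ℝ) < m := by exact_mod_cast hm
  set u := 1/(m:ℝ) with hu
  have hu0 : 0 < u := by positivity
  have hu1 : u ≤ 1 := by
    rw [hu, div_le_one hm']; exact_mod_cast hm
  have hB : ∀ k : ℕ, k ≤ m/2 → IsBranch c ((k:ℝ)/m) (fIsing β ((k:ℝ)/m)) := by
    intro k hk
    apply hbr
    · positivity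
    · rw [div_le_div_iff₀ hm' (by norm_num)]
      have : k*2 ≤ 1*m := by omega
      exact_mod_cast this
  have htu : ∀ k : ℕ, ((k+1:ℕ):ℝ)/m - (k:ℝ)/m = u := by
    intro k; push_cast; rw [hu]; ring
  set b : ℕ → ℝ := fun k => branchB c u ((k:ℝ)/m) (fIsing β ((k:ℝ)/m)) with hb
  set d : ℕ → ℝ := fun k => |hseq β m k - b k| with hd
  set r : ℕ → ℝ := fun k => (k:ℝ)/m/(1-(k:ℝ)/m)/(hseq β m k*b k) with hr
  have hbp : ∀ k, k ≤ m/2 → 0 < b k := fun k hk => branchB_pos hc hc1 hu0.le (hB k hk)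
  have hhp : ∀ k, 1 ≤ k → k ≤ m/2 → 0 < hseq β m k := fun k h1 hk =>
    lt_of_lt_of_le hc (hbd m k h1 hk).1
  have htau : ∀ k : ℕ, k ≤ m/2 → 0 ≤ (k:ℝ)/m/(1-(k:ℝ)/m) ∧ (k:ℝ)/m/(1-(k:ℝ)/m) ≤ 1 := by
    intro k hk
    have h0 := (hB k hk).t0
    have h1 := (hB k hk).t1
    constructor
    · exact div_nonneg h0 (by linarith)
    · rw [div_le_one (by linarith)]; linarith
  have hr0 : ∀ k, 1 ≤ k → k ≤ m/2 → 0 ≤ r k := fun k h1 hk =>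
    div_nonneg (htau k hk).1 (mul_pos (hhp k h1 hk) (hbp k hk)).le
  have hrR : ∀ k, 1 ≤ k → k ≤ m/2 → r k ≤ R := by
    intro k h1 hk
    have a1 := (htau k hk).2
    have a2 := (hbd m k h1 hk).1
    have a3 : c^2/(1+8/c^2) ≤ b k := branchB_inv hc hc1 hu0.le hu1 (hB k hk)
    have a4 := hhp k h1 hk
    simp only [hr, hR]
    gcongr
  have hstep : ∀ k, 1 ≤ k → k+1 ≤ m/2 → d (k+1) ≤ r k*d k + E*u^2 := by
    intro k h1 hk
    have hp1 := hhp k h1 (by omega)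
    have hp2 := hbp k (by omega)
    have e : hseq β m (k+1) - b (k+1) =
        -(r k*(hseq β m k - b k)) + (c*(1-2*((k:ℝ)/m))/(1-(k:ℝ)/m)
          + (k:ℝ)/m/(1-(k:ℝ)/m)/b k - b (k+1)) := by
      rw [hst m k h1 hm (by omega)]
      simp only [hr]
      generalize (k:ℝ)/m/(1-(k:ℝ)/m) = τ
      generalize c*(1-2*((k:ℝ)/m))/(1-(k:ℝ)/m) = z
      generalize b (k+1) = b'
      generalize hseq β m k = y at *
      generalize b k = x at *
      field_simp
      ring
    have := branchB_step hc hc1 hu0.le (hB k (by omega)) (hB (k+1) hk) (htu k)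
    simp only [hd]
    rw [e]
    refine (abs_add_le _ _).trans ?_
    rw [abs_neg, abs_mul, abs_of_nonneg (hr0 k h1 (by omega))]
    exact add_le_add le_rfl this
  have hrr : ∀ k, 1 ≤ k → k+2 ≤ m/2 → r (k+1)*r k ≤ (1+A*u)^2 := by
    intro k h1 hk
    have hp1 := hhp k h1 (by omega)
    have hp2 := hbp k (by omega)
    have hp3 := hhp (k+1) (by omega) (by omega)
    have hp4 := hbp (k+1) (by omega)
    have hprod : (k:ℝ)/m/(1-(k:ℝ)/m) ≤ hseq β m k*hseq β m (k+1) := by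
      rw [hst m k h1 hm (by omega), mul_add, mul_div_cancel₀ _ hp1.ne']
      have h0 := (hB k (by omega)).t1
      have : 0 ≤ c*(1-2*((k:ℝ)/m))/(1-(k:ℝ)/m) :=
        div_nonneg (mul_nonneg hc.le (by linarith)) (by linarith)
      have := mul_nonneg hp1.le this
      linarith
    have hq := branchB_prod hc hc1 hu0.le (hB k (by omega)) (hB (k+1) (by omega)) (htu k)
    refine le_trans ?_ hq
    have t1 := (htau (k+1) (by omega)).1
    have t0 := (htau k (by omega)).1
    change _ ≤ ((k+1:ℕ):ℝ)/m/(1-((k+1:ℕ):ℝ)/m)/(b k*b (k+1))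
    simp only [hr]
    generalize ((k+1:ℕ):ℝ)/m/(1-((k+1:ℕ):ℝ)/m) = τ' at *
    generalize (k:ℝ)/m/(1-(k:ℝ)/m) = τ at *
    generalize hseq β m (k+1) = y' at *
    generalize b (k+1) = x' at *
    generalize hseq β m k = y at *
    generalize b k = x at *
    have e : τ'/(y'*x')*(τ/(y*x)) = τ'/(x*x')*(τ/(y*y')) := by field_simp
    rw [e]
    apply mul_le_of_le_one_right (by positivity)
    rw [div_le_one (by positivity)]; exact hprod
  have hnear : ∀ k, k ≤ m/2 → |b k - fIsing β ((k:ℝ)/m)| ≤ 8/c^2*u := fun k hk =>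
    branchB_near hc hc1 hu0.le (hB k hk)
  have hlip : ∀ k, k+1 ≤ m/2 → |fIsing β (((k+1:ℕ):ℝ)/m) - fIsing β ((k:ℝ)/m)| ≤ 4/c*u := by
    intro k hk
    have := branch_lip hc hc1 (hB k (by omega)) (hB (k+1) hk)
    rwa [htu, abs_of_pos hu0] at this
  have hbf : ∀ k, k+1 ≤ m/2 → |b (k+1) - fIsing β ((k:ℝ)/m)| ≤ D1*u := by
    intro k hk
    have := abs_sub_le (b (k+1)) (fIsing β (((k+1:ℕ):ℝ)/m)) (fIsing β ((k:ℝ)/m))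
    have a := hnear (k+1) hk
    have a' := hlip k hk
    rw [hD1]; linarith
  have hd1 : 1 ≤ m/2 → d 1 ≤ D1*u := by
    intro h
    have := hbf 0 h
    simp only [Nat.cast_zero, zero_div, hf0, zero_add] at this
    simp only [hd, hone]
    rwa [abs_sub_comm]
  have huu : u^2 ≤ u := by nlinarith
  have hdd1 : 1 ≤ m/2 → d 1 ≤ D*u := by
    intro h
    refine (hd1 h).trans ?_
    gcongr
    rw [hD]
    nlinarith [mul_pos hRp hD1p]
  have hdd2 : 2 ≤ m/2 → d 2 ≤ D*u := by
    intro h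
    have a := hstep 1 le_rfl h
    have a1 := hd1 (by omega)
    have a2 : r 1*d 1 ≤ R*(D1*u) :=
      mul_le_mul (hrR 1 le_rfl (by omega)) a1 (abs_nonneg _) hRp.le
    have a3 : E*u^2 ≤ E*u := by gcongr
    have a4 : 0 ≤ D1*u := by positivity
    have e : D*u = D1*u + R*(D1*u) + E*u := by rw [hD]; ring
    have a5 : d (1+1) = d 2 := rfl
    linarith
  have hg := two_step_gronwall d (m/2) ((1+A*u)^2) (D*u) ((R+1)*E*u^2)
    (by have : 0 < A*u := by positivity
        nlinarith) (by positivity) (by positivity) hdd1 hdd2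
    (by
      intro k h1 hk
      have a := hstep (k+1) (by omega) hk
      have a' := hstep k h1 (by omega)
      have b1 := mul_le_mul_of_nonneg_left a' (hr0 (k+1) (by omega) (by omega))
      have b2 := mul_le_mul_of_nonneg_right (hrr k h1 hk) (abs_nonneg (hseq β m k - b k))
      change r (k+1)*r k*d k ≤ (1+A*u)^2*d k at b2
      have b3 := mul_le_mul_of_nonneg_right (hrR (k+1) (by omega) (by omega))
        (by positivity : 0 ≤ E*u^2)
      have e : k+1+1 = k+2 := rfl
      rw [e] at a
      linarith)
  intro k h1 hk
  have hk2 := hg k h1 hk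
  have hku : (k:ℝ)*u ≤ 1 := by
    rw [hu, mul_one_div, div_le_one hm']
    have : k ≤ m := by omega
    exact_mod_cast this
  have hexp : ((1+A*u)^2)^k ≤ Real.exp (2*A) := by
    have a : 1+A*u ≤ Real.exp (A*u) := by linarith [Real.add_one_le_exp (A*u)]
    calc ((1+A*u)^2)^k ≤ ((Real.exp (A*u))^2)^k := by gcongr
      _ = Real.exp (2*A*((k:ℝ)*u)) := by
        rw [← pow_mul, ← Real.exp_nat_mul]; congr 1; push_cast; ring
      _ ≤ Real.exp (2*A) := by
        apply Real.exp_le_exp.2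
        have : 2*A*((k:ℝ)*u) ≤ 2*A*1 := by gcongr
        linarith
  have hlast : D*u + (k:ℝ)*((R+1)*E*u^2) ≤ (D+(R+1)*E)*u := by
    have : (k:ℝ)*u*((R+1)*E*u) ≤ 1*((R+1)*E*u) := by gcongr
    nlinarith
  have hdk : d k ≤ Real.exp (2*A)*((D+(R+1)*E)*u) := by
    refine hk2.trans ?_
    gcongr
  obtain ⟨j, rfl⟩ : ∃ j, k = j+1 := ⟨k-1, by omega⟩
  have hfin := hbf j hk
  have e : (((j+1:ℕ):ℝ)-1)/(m:ℝ) = (j:ℝ)/m := by push_cast; ring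
  rw [e]
  have := abs_sub_le (hseq β m (j+1)) (b (j+1)) (fIsing β ((j:ℝ)/m))
  have e2 : (Real.exp (2*A)*(D+(R+1)*E) + D1)/(m:ℝ)
      = Real.exp (2*A)*((D+(R+1)*E)*u) + D1*u := by rw [hu]; ring
  rw [e2]
  change d (j+1) ≤ _ at hdk
  simp only [hd] at hdk
  linarith
end

section
/- For every β > 0 and every t ∈ [0,1/2], F(β,t) = t·log f(β,t) + (1/2)·log(1−t) + (1/2)·log(1 + e^{−2β}) + (1/2)·log( 1 + e^{−2β}(2t−1)/( (1−t)(f(β,t)+1) ) ). -/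
open Filter MeasureTheory

lemma fIsing_facts (β : ℝ) (hβ : 0 < β) (t : ℝ) (h0 : 0 ≤ t) (h1 : t ≤ 1/2) :
    0 < fIsing β t ∧ DifferentiableAt ℝ (fIsing β) t ∧
    (1-t) * fIsing β t^2 - Real.exp (-2*β) * (1-2*t) * fIsing β t - t = 0 := by
  have hc0 : 0 < Real.exp (-2*β) := Real.exp_pos _
  have hc1 : Real.exp (-2*β) < 1 := by
    rw [Real.exp_lt_one_iff]; linarith
  unfold fIsing
  generalize Real.exp (-2*β) = c at *
  have hc2 : 0 < c^2 := by positivity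
  have hA : 0 < 1 + (c^2-1)*(1-2*t)^2 := by
    have e : 1 + (c^2-1)*(1-2*t)^2 = c^2*(1-2*t)^2 + 4*t*(1-t) := by ring
    rcases h0.eq_or_lt with h | h
    · rw [← h]; nlinarith
    · rw [e]
      have : 0 < 4*t*(1-t) := mul_pos (by linarith) (by linarith)
      positivity
  have h2 : 0 < 1 - t := by linarith
  have hs := Real.sqrt_pos.2 hA
  have hsq := Real.sq_sqrt hA.le
  refine ⟨?_, ?_, ?_⟩
  · have : 0 ≤ c*(1-2*t) := mul_nonneg hc0.le (by linarith)
    positivity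
  · have : DifferentiableAt ℝ (fun t : ℝ => Real.sqrt (1 + (c^2-1)*(1-2*t)^2)) t :=
      DifferentiableAt.sqrt (by fun_prop) hA.ne'
    refine DifferentiableAt.div (by fun_prop) (by fun_prop) (by positivity)
  · generalize Real.sqrt (1 + (c^2-1)*(1-2*t)^2) = s at *
    field_simp
    linear_combination hsq

lemma quad_facts (c f t : ℝ) (hc0 : 0 < c) (hc1 : c < 1) (ht : t < 1) (hf : 0 < f)
    (h : (1-t) * f^2 - c * (1-2*t) * f - t = 0) :
    0 < f^2 - 2*c*f + 1 ∧ t * (f^2 - 2*c*f + 1) = f^2 - c*f ∧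
    1 + c*(2*t-1)/((1-t)*(f+1)) = (1-c)/(f^2-2*c*f+1)/(1-t) := by
  have hD : 0 < f^2 - 2*c*f + 1 := by nlinarith [sq_nonneg (f-c)]
  have h1 : 0 < 1 - t := by linarith
  have htD : t * (f^2 - 2*c*f + 1) = f^2 - c*f := by linear_combination -h
  refine ⟨hD, htD, ?_⟩
  have e : t = (f^2-c*f)/(f^2 - 2*c*f + 1) := by
    rw [eq_div_iff hD.ne']; exact htD
  have hf1 : 0 < f + 1 := by linarith
  rw [div_div, eq_div_iff (by positivity)]
  field_simp
  have : 1 - t = (1-c*f)/(f^2 - 2*c*f + 1) := by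
    rw [eq_div_iff hD.ne']; linear_combination -htD
  linear_combination (-(f+1) + 2 * c) * htD

/-- explicit formula for `F(β,t)` on `[0,1/2]`. -/
theorem FIsing_explicit (β : ℝ) (hβ : 0 < β) (t : ℝ) (ht : t ∈ Set.Icc (0:ℝ) (1/2)) :
    FIsing β t = t * Real.log (fIsing β t) + (1/2) * Real.log (1-t)
      + (1/2) * Real.log (1 + Real.exp (-2*β))
      + (1/2) * Real.log (1 + Real.exp (-2*β) * (2*t-1) / ((1-t) * (fIsing β t + 1))) := by
  obtain ⟨h0, h1⟩ := ht
  have hc0 : 0 < Real.exp (-2*β) := Real.exp_pos _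
  have hc1 : Real.exp (-2*β) < 1 := by
    rw [Real.exp_lt_one_iff]; linarith
  have key : ∀ s ∈ Set.Icc (0:ℝ) (1/2), HasDerivAt (fun s => s * Real.log (fIsing β s)
      - (1/2) * Real.log (fIsing β s^2 - 2*Real.exp (-2*β)*fIsing β s + 1))
      (Real.log (fIsing β s)) s := by
    intro s hs
    obtain ⟨hf, hd, hq⟩ := fIsing_facts β hβ s hs.1 hs.2
    obtain ⟨hD, htD, -⟩ := quad_facts _ _ s hc0 hc1 (by linarith [hs.2]) hf hq
    have hd' := hd.hasDerivAt
    have := ((hasDerivAt_id s).mul (hd'.log hf.ne')).sub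
      (((((hd'.pow 2).sub (hd'.const_mul (2*Real.exp (-2*β)))).add_const 1).log hD.ne').const_mul
        (1/2))
    refine this.congr_deriv ?_
    simp only [id, Pi.pow_apply, Pi.sub_apply]
    have e : s = (fIsing β s^2 - Real.exp (-2*β) * fIsing β s) /
        (fIsing β s^2 - 2*Real.exp (-2*β)*fIsing β s + 1) := by
      rw [eq_div_iff hD.ne']; exact htD
    generalize deriv (fIsing β) s = d at *
    generalize Real.exp (-2*β) = c at *
    generalize fIsing β s = f at *
    have e2 : s * (d / f) = (f - c) * d / (f^2 - 2*c*f + 1) := by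
      rw [e]; field_simp
    rw [e2]
    field_simp
    push_cast
    ring
  have hint : FIsing β t = (t * Real.log (fIsing β t)
      - (1/2) * Real.log (fIsing β t^2 - 2*Real.exp (-2*β)*fIsing β t + 1))
      - (0 * Real.log (fIsing β 0)
      - (1/2) * Real.log (fIsing β 0^2 - 2*Real.exp (-2*β)*fIsing β 0 + 1)) := by
    unfold FIsing
    rw [min_eq_left (by linarith)]
    refine intervalIntegral.integral_eq_sub_of_hasDerivAt (fun s hs => key s ?_) ?_
    · rw [Set.uIcc_of_le h0] at hs
      exact ⟨hs.1, hs.2.trans h1⟩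
    · refine ContinuousOn.intervalIntegrable fun s hs => ?_
      rw [Set.uIcc_of_le h0] at hs
      obtain ⟨hf, hd, -⟩ := fIsing_facts β hβ s hs.1 (hs.2.trans h1)
      exact (hd.continuousAt.log hf.ne').continuousWithinAt
  rw [hint]
  obtain ⟨hf, hd, hq⟩ := fIsing_facts β hβ t h0 h1
  obtain ⟨hD, htD, hE⟩ := quad_facts _ _ t hc0 hc1 (by linarith) hf hq
  have hf0 : fIsing β 0 = Real.exp (-2*β) := by
    unfold fIsing
    have : (1 + (Real.exp (-2*β)^2 - 1) * (1 - 2*0)^2) = Real.exp (-2*β)^2 := by ring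
    rw [this, Real.sqrt_sq hc0.le]; ring
  rw [hE, hf0, Real.log_div (div_pos (by linarith) hD).ne' (by linarith),
    Real.log_div (by linarith) hD.ne']
  have : Real.exp (-2*β)^2 - 2*Real.exp (-2*β)*Real.exp (-2*β) + 1
      = (1 + Real.exp (-2*β)) * (1 - Real.exp (-2*β)) := by ring
  simp only [this]
  rw [Real.log_mul (by linarith) (by linarith)]
  ring
end

section
/- For every x > 0 and every y ∈ ℝ, setting v = tanh( y + atanh( tanh(x)·tanh(y) ) ), one has ( e^{−2x}·v + sqrt( 1 + (e^{−4x} − 1)·v² ) ) / (v + 1) = cosh(x−y)/cosh(x+y). -/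
open Filter MeasureTheory

theorem tanh_exp_sq (w : ℝ) : Real.tanh w = (Real.exp w ^ 2 - 1) / (Real.exp w ^ 2 + 1) := by
  rw [Real.tanh_eq_sinh_div_cosh, Real.sinh_eq, Real.cosh_eq, Real.exp_neg]
  have := Real.exp_pos w
  field_simp

theorem v_formula (x y : ℝ) : Real.tanh (y + artanh (Real.tanh x * Real.tanh y)) =
    Real.exp x ^ 2 * (Real.exp y ^ 4 - 1) /
      (Real.exp x ^ 2 * Real.exp y ^ 4 + 2 * Real.exp y ^ 2 + Real.exp x ^ 2) := by
  have hr : (1 + Real.tanh x * Real.tanh y) / (1 - Real.tanh x * Real.tanh y) =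
      (Real.exp x ^ 2 * Real.exp y ^ 2 + 1) / (Real.exp x ^ 2 + Real.exp y ^ 2) := by
    rw [tanh_exp_sq x, tanh_exp_sq y]
    have ha := Real.exp_pos x
    have hb := Real.exp_pos y
    generalize Real.exp x = a at *
    generalize Real.exp y = b at *
    have h1 : 1 + (a ^ 2 - 1) / (a ^ 2 + 1) * ((b ^ 2 - 1) / (b ^ 2 + 1)) =
        2 * (a ^ 2 * b ^ 2 + 1) / ((a ^ 2 + 1) * (b ^ 2 + 1)) := by
      field_simp
      ring
    have h2 : 1 - (a ^ 2 - 1) / (a ^ 2 + 1) * ((b ^ 2 - 1) / (b ^ 2 + 1)) =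
        2 * (a ^ 2 + b ^ 2) / ((a ^ 2 + 1) * (b ^ 2 + 1)) := by
      field_simp
      ring
    rw [h1, h2]
    field_simp
  have he : Real.exp (y + artanh (Real.tanh x * Real.tanh y)) ^ 2 = Real.exp y ^ 2 *
      ((Real.exp x ^ 2 * Real.exp y ^ 2 + 1) / (Real.exp x ^ 2 + Real.exp y ^ 2)) := by
    rw [Real.exp_add, mul_pow, artanh, hr, ← Real.exp_nat_mul _ 2]
    congr 1
    rw [← Real.exp_nat_mul]
    have : ∀ t : ℝ, ((2 : ℕ) : ℝ) * (1 / 2 * t) = t := by intro t; push_cast; ring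
    rw [this, Real.exp_log (by positivity)]
  rw [tanh_exp_sq, he]
  have ha := Real.exp_pos x
  have hb := Real.exp_pos y
  generalize Real.exp x = a at *
  generalize Real.exp y = b at *
  rw [div_eq_div_iff (by positivity) (by positivity)]
  field_simp
  ring

/-- the hyperbolic identity (E). -/
theorem hyperbolic_identity (x y : ℝ) (hx : 0 < x) :
    (Real.exp (-2*x) * Real.tanh (y + artanh (Real.tanh x * Real.tanh y)) +
        Real.sqrt (1 + (Real.exp (-4*x) - 1) *
          (Real.tanh (y + artanh (Real.tanh x * Real.tanh y)))^2)) /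
      (Real.tanh (y + artanh (Real.tanh x * Real.tanh y)) + 1)
    = Real.cosh (x-y) / Real.cosh (x+y) := by
  rw [v_formula]
  have h2 : Real.exp (-2*x) = 1 / Real.exp x ^ 2 := by
    rw [← Real.exp_nat_mul, one_div, ← Real.exp_neg]; congr 1; push_cast; ring
  have h4 : Real.exp (-4*x) = 1 / Real.exp x ^ 4 := by
    rw [← Real.exp_nat_mul, one_div, ← Real.exp_neg]; congr 1; push_cast; ring
  have hc : Real.cosh (x-y) / Real.cosh (x+y) = (Real.exp x ^ 2 + Real.exp y ^ 2) /
      (Real.exp x ^ 2 * Real.exp y ^ 2 + 1) := by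
    have ha := Real.exp_pos x
    have hb := Real.exp_pos y
    rw [Real.cosh_eq, Real.cosh_eq, Real.exp_neg, Real.exp_neg, Real.exp_sub, Real.exp_add]
    field_simp
  rw [h2, h4, hc]
  have ha := Real.exp_pos x
  have hb := Real.exp_pos y
  generalize Real.exp x = a at *
  generalize Real.exp y = b at *
  have hs : 1 + (1 / a ^ 4 - 1) *
      (a ^ 2 * (b ^ 4 - 1) / (a ^ 2 * b ^ 4 + 2 * b ^ 2 + a ^ 2)) ^ 2 =
      ((b ^ 4 + 1 + 2 * a ^ 2 * b ^ 2) / (a ^ 2 * b ^ 4 + 2 * b ^ 2 + a ^ 2)) ^ 2 := by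
    field_simp
    ring
  rw [hs, Real.sqrt_sq (by positivity)]
  have hn : 1 / a ^ 2 * (a ^ 2 * (b ^ 4 - 1) / (a ^ 2 * b ^ 4 + 2 * b ^ 2 + a ^ 2)) +
      (b ^ 4 + 1 + 2 * a ^ 2 * b ^ 2) / (a ^ 2 * b ^ 4 + 2 * b ^ 2 + a ^ 2) =
      2 * b ^ 2 * (a ^ 2 + b ^ 2) / (a ^ 2 * b ^ 4 + 2 * b ^ 2 + a ^ 2) := by
    field_simp
    ring
  have hd : a ^ 2 * (b ^ 4 - 1) / (a ^ 2 * b ^ 4 + 2 * b ^ 2 + a ^ 2) + 1 =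
      2 * b ^ 2 * (a ^ 2 * b ^ 2 + 1) / (a ^ 2 * b ^ 4 + 2 * b ^ 2 + a ^ 2) := by
    field_simp
    ring
  rw [hn, hd]
  field_simp
end
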